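/- Fix B > 0, b > 0 and let S = ℝ × (0,B). Let u be a twice continuously differentiable function on ℝ × [0,B] such that e^{2bx}u², e^{2bx}u_x², e^{2bx}u_y² and e^{2bx}u_{xy}² are integrable on S, e^{bx}u(x,y) → 0 as |x| → ∞ uniformly in y ∈ [0,B], and for every x ∈ ℝ there exists y₀ ∈ [0,B] with u(x,y₀) = 0. Then for every δ > 0: sup_{(x,y) ∈ S} e^{2bx} u(x,y)² ≤ δ(1 + 2b²) ∫_S e^{2bx} u_y² dx dy + 2δ ∫_S e^{2bx} u_{xy}² dx dy + (2/δ) ∫_S e^{2bx} u_x² dx dy + (1/δ)(1 + 2b²) ∫_S e^{2bx} u² dx dy. -/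

import Mathlib

open MeasureTheory Real Set

/-- The strip `S = ℝ × (0, B)`. -/
def strip (B : ℝ) : Set (ℝ × ℝ) := Set.univ ×ˢ Set.Ioo 0 B

/-- An integrable real function on the line takes values below any `ε > 0` arbitrarily far to the
left. -/
theorem exists_le_lt_of_integrable {G : ℝ → ℝ} (hG : Integrable G) (x : ℝ) {ε : ℝ} (hε : 0 < ε) :
    ∃ s ≤ x, G s < ε := by
  by_contra! h
  have hc : IntegrableOn (fun _ : ℝ => ε) (Iic x) := by
    refine Integrable.mono' hG.integrableOn aestronglyMeasurable_const ?_
    filter_upwards [ae_restrict_mem measurableSet_Iic] with s hs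
    rw [Real.norm_of_nonneg hε.le]
    exact h s hs
  rw [integrableOn_const_iff (by simp)] at hc
  simp [hε.ne'] at hc

/-- If `g` and its first partial derivative `h` are integrable on `ℝ × Y`, then every slice of `g`
has `L¹` norm at most that of `h`. -/
theorem integral_abs_slice_le {Y : Type*} [MeasurableSpace Y] {μ : Measure Y} [SFinite μ]
    {g h : ℝ × Y → ℝ} (hg : Integrable g (volume.prod μ)) (hh : Integrable h (volume.prod μ))
    (hslice : ∀ x, Integrable (fun y => g (x, y)) μ)
    (hderiv : ∀ x y, HasDerivAt (fun t => g (t, y)) (h (x, y)) x) (x : ℝ) :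
    ∫ y, |g (x, y)| ∂μ ≤ ∫ p, |h p| ∂(volume.prod μ) := by
  have step : ∀ s ≤ x, ∫ y, |g (x, y)| ∂μ ≤
      ∫ y, |g (s, y)| ∂μ + ∫ p, |h p| ∂(volume.prod μ) := by
    intro s hs
    rw [integral_prod_symm _ hh.abs, ← integral_add (hslice s).abs hh.abs.integral_prod_right]
    refine integral_mono_ae (hslice x).abs ((hslice s).abs.add hh.abs.integral_prod_right) ?_
    filter_upwards [hh.prod_left_ae] with y hy
    have hftc := intervalIntegral.integral_eq_sub_of_hasDerivAt
      (fun t _ => hderiv t y) (hy.intervalIntegrable (a := s) (b := x))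
    have hle : |∫ t in s..x, h (t, y)| ≤ ∫ t, |h (t, y)| :=
      (intervalIntegral.abs_integral_le_integral_abs hs).trans <| by
        rw [intervalIntegral.integral_of_le hs]
        exact setIntegral_le_integral hy.abs (ae_of_all _ fun t => abs_nonneg _)
    rw [hftc] at hle
    have := abs_sub_abs_le_abs_sub (g (x, y)) (g (s, y))
    change |g (x, y)| ≤ |g (s, y)| + ∫ t, |h (t, y)|
    linarith
  refine le_of_forall_pos_le_add fun ε hε => ?_
  obtain ⟨s, hs, hsε⟩ := exists_le_lt_of_integrable hg.abs.integral_prod_left x hε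
  linarith [step s hs]

/-- A `C¹` function vanishing somewhere on `[0, B]` satisfies `f² ≤ 2 ∫ |f f'|` there. -/
theorem sq_le_two_mul_integral_abs_mul_deriv {B : ℝ} {f f' : ℝ → ℝ}
    (hderiv : ∀ y, HasDerivAt f (f' y) y) (hf' : Continuous f') {y₀ y : ℝ}
    (hy₀ : y₀ ∈ Icc 0 B) (hy : y ∈ Icc 0 B) (hzero : f y₀ = 0) :
    f y ^ 2 ≤ 2 * ∫ z in Ioo 0 B, |f z * f' z| := by
  have hf : Continuous f := continuous_iff_continuousAt.2 fun z => (hderiv z).continuousAt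
  have hcont : Continuous fun z => 2 * (f z * f' z) := by fun_prop
  have hftc : ∫ z in y₀..y, 2 * (f z * f' z) = f y ^ 2 - f y₀ ^ 2 :=
    intervalIntegral.integral_eq_sub_of_hasDerivAt (f := fun z => f z ^ 2)
      (fun z _ => ((hderiv z).pow 2).congr_deriv (by ring)) (hcont.intervalIntegrable _ _)
  have hsub : uIoc y₀ y ⊆ Icc 0 B :=
    uIoc_subset_uIcc.trans (uIcc_subset_Icc hy₀ hy)
  calc f y ^ 2 = ∫ z in y₀..y, 2 * (f z * f' z) := by rw [hftc, hzero]; ring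
    _ ≤ ∫ z in uIoc y₀ y, |2 * (f z * f' z)| :=
        (le_abs_self _).trans <| by
          simpa only [Real.norm_eq_abs] using intervalIntegral.norm_integral_le_integral_norm_uIoc
            (f := fun z => 2 * (f z * f' z)) (a := y₀) (b := y) (μ := volume)
    _ ≤ ∫ z in Icc 0 B, |2 * (f z * f' z)| :=
        setIntegral_mono_set (hcont.abs.integrableOn_Icc) (ae_of_all _ fun z => abs_nonneg _)
          hsub.eventuallyLE
    _ = 2 * ∫ z in Ioo 0 B, |f z * f' z| := by
        simp_rw [abs_mul (2 : ℝ), integral_Icc_eq_integral_Ioo, integral_const_mul]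
        simp

/-- The first and mixed partial derivatives of a `C²` function of two real variables: they are
continuous, and the mixed ones agree. -/
theorem exists_continuous_partial_derivatives {u : ℝ → ℝ → ℝ}
    (hu : ContDiff ℝ 2 (fun p : ℝ × ℝ => u p.1 p.2)) :
    ∃ ux uy uxy : ℝ × ℝ → ℝ, Continuous ux ∧ Continuous uy ∧ Continuous uxy ∧
      (∀ x y, HasDerivAt (fun t => u t y) (ux (x, y)) x) ∧
      (∀ x y, HasDerivAt (fun t => u x t) (uy (x, y)) y) ∧
      (∀ x y, HasDerivAt (fun t => ux (x, t)) (uxy (x, y)) y) ∧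
      (∀ x y, HasDerivAt (fun t => uy (t, y)) (uxy (x, y)) x) := by
  set U : ℝ × ℝ → ℝ := fun p => u p.1 p.2
  have hx : ∀ x y : ℝ, HasDerivAt (fun t : ℝ => (t, y)) ((1, 0) : ℝ × ℝ) x := fun x y =>
    (hasDerivAt_id x).prodMk (hasDerivAt_const x y)
  have hy : ∀ x y : ℝ, HasDerivAt (fun t : ℝ => (x, t)) ((0, 1) : ℝ × ℝ) y := fun x y =>
    (hasDerivAt_const y x).prodMk (hasDerivAt_id y)
  have hU : Differentiable ℝ U := hu.differentiable (by norm_num)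
  have hU' : ContDiff ℝ 1 (fderiv ℝ U) := hu.fderiv_right (by norm_num)
  have hU'd : Differentiable ℝ (fderiv ℝ U) := hU'.differentiable (by norm_num)
  have hU'' : Continuous (fderiv ℝ (fderiv ℝ U)) := hU'.continuous_fderiv (by norm_num)
  have happ : ∀ (p v : ℝ × ℝ), HasFDerivAt (fun q => fderiv ℝ U q v)
      ((fderiv ℝ (fderiv ℝ U) p).flip v) p := fun p v => by
    simpa using (hU'd p).hasFDerivAt.clm_apply (hasFDerivAt_const v p)
  refine ⟨fun p => fderiv ℝ U p (1, 0), fun p => fderiv ℝ U p (0, 1),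
    fun p => fderiv ℝ (fderiv ℝ U) p (0, 1) (1, 0), by fun_prop, by fun_prop, by fun_prop,
    fun x y => ?_, fun x y => ?_, fun x y => ?_, fun x y => ?_⟩
  · exact (hU (x, y)).hasFDerivAt.comp_hasDerivAt x (hx x y)
  · exact (hU (x, y)).hasFDerivAt.comp_hasDerivAt y (hy x y)
  · exact (happ (x, y) (1, 0)).comp_hasDerivAt y (hy x y)
  · have hsymm := (hu.contDiffAt (x := (x, y))).isSymmSndFDerivAt (by simp)
    have hd := (happ (x, y) (0, 1)).comp_hasDerivAt x (hx x y)
    exact hd.congr_deriv (hsymm.eq _ _)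

/-- Young's inequality for the derivative `(c + b a) d + a (e + b d)` of a weighted product. -/
theorem abs_weighted_product_derivative_le {δ : ℝ} (hδ : 0 < δ) (b a c d e : ℝ) :
    |(c + b * a) * d + a * (e + b * d)| ≤
      (δ * (1 + 2 * b ^ 2) * d ^ 2 + 2 * δ * e ^ 2 + 2 / δ * c ^ 2
        + 1 / δ * (1 + 2 * b ^ 2) * a ^ 2) / 2 := by
  have young : ∀ s t : ℝ, |s * t| ≤ (1 / δ * s ^ 2 + δ * t ^ 2) / 2 := fun s t => by
    have h : (1 / δ * s ^ 2 + δ * t ^ 2) / 2 - |s * t| = (|s| - δ * |t|) ^ 2 / (2 * δ) := by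
      rw [abs_mul, ← sq_abs s, ← sq_abs t]
      field_simp
      ring
    have : 0 ≤ (|s| - δ * |t|) ^ 2 / (2 * δ) := by positivity
    linarith
  have hc : 1 / δ * (c + b * a) ^ 2 ≤ 1 / δ * (2 * c ^ 2 + 2 * b ^ 2 * a ^ 2) :=
    mul_le_mul_of_nonneg_left (by nlinarith [sq_nonneg (c - b * a)]) (by positivity)
  have he : δ * (e + b * d) ^ 2 ≤ δ * (2 * e ^ 2 + 2 * b ^ 2 * d ^ 2) :=
    mul_le_mul_of_nonneg_left (by nlinarith [sq_nonneg (e - b * d)]) hδ.le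
  have h2 : 2 / δ * c ^ 2 = 1 / δ * (2 * c ^ 2) := by ring
  have := abs_add_le ((c + b * a) * d) (a * (e + b * d))
  linarith [young (c + b * a) d, young a (e + b * d)]

/-- Lebesgue measure on the strip is a product measure. -/
theorem volume_restrict_strip (B : ℝ) :
    (volume : Measure (ℝ × ℝ)).restrict (strip B) =
      (volume : Measure ℝ).prod (volume.restrict (Ioo 0 B)) := by
  rw [strip, Measure.volume_eq_prod, ← Measure.prod_restrict, Measure.restrict_univ]

/-- **Weighted supremum estimate** (Lemma 3.3 of the paper). Fix `B > 0`, `b > 0`.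
Let `u` be twice continuously differentiable on the strip, with `e^{2bx}u²`,
`e^{2bx}u_x²`, `e^{2bx}u_y²`, `e^{2bx}u_xy²` integrable on `S`,
`e^{bx}u(x,y) → 0` as `|x| → ∞` uniformly in `y ∈ [0,B]`, and such that for every
`x` there is `y₀ ∈ [0,B]` with `u(x,y₀) = 0`. Then for every `δ > 0`,
`sup_S e^{2bx} u² ≤ δ(1+2b²) ∫_S e^{2bx}u_y² + 2δ ∫_S e^{2bx}u_xy²
  + (2/δ) ∫_S e^{2bx}u_x² + (1/δ)(1+2b²) ∫_S e^{2bx}u²`. -/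
theorem weighted_sup_estimate_strip (B b : ℝ) (hB : 0 < B) (hb : 0 < b) (u : ℝ → ℝ → ℝ)
    (hu : ContDiff ℝ 2 (fun p : ℝ × ℝ => u p.1 p.2))
    (hu2 : IntegrableOn (fun p : ℝ × ℝ => Real.exp (2*b*p.1) * (u p.1 p.2)^2)
      (strip B) volume)
    (hux2 : IntegrableOn
      (fun p : ℝ × ℝ => Real.exp (2*b*p.1) * (deriv (fun x => u x p.2) p.1)^2)
      (strip B) volume)
    (huy2 : IntegrableOn
      (fun p : ℝ × ℝ => Real.exp (2*b*p.1) * (deriv (fun y => u p.1 y) p.2)^2)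
      (strip B) volume)
    (huxy2 : IntegrableOn
      (fun p : ℝ × ℝ => Real.exp (2*b*p.1) * (deriv (fun y => deriv (fun x => u x y) p.1) p.2)^2)
      (strip B) volume)
    (hdecay : ∀ ε : ℝ, 0 < ε → ∃ R : ℝ, ∀ x : ℝ, R ≤ |x| → ∀ y ∈ Set.Icc (0:ℝ) B,
      |Real.exp (b*x) * u x y| ≤ ε)
    (hzero : ∀ x : ℝ, ∃ y₀ ∈ Set.Icc (0:ℝ) B, u x y₀ = 0) :
    ∀ δ : ℝ, 0 < δ → ∀ x : ℝ, ∀ y ∈ Set.Ioo (0:ℝ) B,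
      Real.exp (2*b*x) * (u x y)^2 ≤
        δ*(1 + 2*b^2) * (∫ p in strip B, Real.exp (2*b*p.1) * (deriv (fun y' => u p.1 y') p.2)^2)
        + 2*δ * (∫ p in strip B,
            Real.exp (2*b*p.1) * (deriv (fun y' => deriv (fun x' => u x' y') p.1) p.2)^2)
        + (2/δ) * (∫ p in strip B, Real.exp (2*b*p.1) * (deriv (fun x' => u x' p.2) p.1)^2)
        + (1/δ)*(1 + 2*b^2) * (∫ p in strip B, Real.exp (2*b*p.1) * (u p.1 p.2)^2) := by
  intro δ hδ x y hy
  obtain ⟨ux, uy, uxy, cux, cuy, cuxy, dx, dy, dxy, dyx⟩ :=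
    exists_continuous_partial_derivatives hu
  have cu : Continuous fun p : ℝ × ℝ => u p.1 p.2 := hu.continuous
  simp only [(dx _ _).deriv, (dy _ _).deriv, (dxy _ _).deriv, Prod.mk.eta, IntegrableOn,
    volume_restrict_strip] at hu2 hux2 huy2 huxy2 ⊢
  set μ : Measure ℝ := volume.restrict (Ioo 0 B)
  let E : ℝ × ℝ → ℝ := fun p => Real.exp (2 * b * p.1)
  let g : ℝ × ℝ → ℝ := fun p => E p * (u p.1 p.2 * uy p)
  let h : ℝ × ℝ → ℝ := fun p =>
    E p * ((ux p + b * u p.1 p.2) * uy p + u p.1 p.2 * (uxy p + b * uy p))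
  have cg : Continuous g := by fun_prop
  have ch : Continuous h := by fun_prop
  have hg : Integrable g (volume.prod μ) := by
    refine (hu2.add huy2).mono' cg.aestronglyMeasurable (ae_of_all _ fun p => ?_)
    have hE : 0 < E p := Real.exp_pos _
    have : |u p.1 p.2 * uy p| ≤ u p.1 p.2 ^ 2 + uy p ^ 2 := by
      rw [abs_le]
      constructor <;> nlinarith [sq_nonneg (u p.1 p.2 - uy p), sq_nonneg (u p.1 p.2 + uy p)]
    change |E p * _| ≤ E p * _ + E p * _
    rw [abs_mul, abs_of_pos hE, ← mul_add]
    exact mul_le_mul_of_nonneg_left this hE.le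
  have hyoung : ∀ p, |h p| ≤ (δ * (1 + 2 * b ^ 2) * (E p * uy p ^ 2) + 2 * δ * (E p * uxy p ^ 2)
      + 2 / δ * (E p * ux p ^ 2) + 1 / δ * (1 + 2 * b ^ 2) * (E p * u p.1 p.2 ^ 2)) / 2 := by
    intro p
    have hE : 0 < E p := Real.exp_pos _
    rw [abs_mul, abs_of_pos hE]
    refine (mul_le_mul_of_nonneg_left
      (abs_weighted_product_derivative_le hδ b (u p.1 p.2) (ux p) (uy p) (uxy p)) hE.le).trans_eq ?_
    ring
  have hy' := huy2.const_mul (δ * (1 + 2 * b ^ 2))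
  have hxy' := huxy2.const_mul (2 * δ)
  have hx' := hux2.const_mul (2 / δ)
  have hu' := hu2.const_mul (1 / δ * (1 + 2 * b ^ 2))
  have hQ := (((hy'.add hxy').add hx').add hu').div_const 2
  have hh : Integrable h (volume.prod μ) :=
    hQ.mono' ch.aestronglyMeasurable (ae_of_all _ hyoung)
  have hderiv : ∀ s z, HasDerivAt (fun t => g (t, z)) (h (s, z)) s := by
    intro s z
    have hexp : HasDerivAt (fun t : ℝ => Real.exp (2 * b * t)) (Real.exp (2 * b * s) * (2 * b)) s :=
      by simpa using ((hasDerivAt_id s).const_mul (2 * b)).exp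
    refine (hexp.mul ((dx s z).mul (dyx s z))).congr_deriv ?_
    simp only [h, E, Pi.mul_apply]
    ring
  have hslice : ∀ s, Integrable (fun z => g (s, z)) μ := fun s =>
    ((cg.comp (by fun_prop : Continuous fun z : ℝ => (s, z))).integrableOn_Icc).mono_set
      Ioo_subset_Icc_self
  have hmain := integral_abs_slice_le hg hh hslice hderiv x
  obtain ⟨y₀, hy₀, hzero₀⟩ := hzero x
  have hsq := sq_le_two_mul_integral_abs_mul_deriv (dy x) (by fun_prop) hy₀
    (Ioo_subset_Icc_self hy) hzero₀
  have hG : ∫ z, |g (x, z)| ∂μ = Real.exp (2 * b * x) * ∫ z in Ioo 0 B, |u x z * uy (x, z)| := by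
    rw [← integral_const_mul]
    refine integral_congr_ae (ae_of_all _ fun z => ?_)
    simp only [g, E, abs_mul (Real.exp _), Real.abs_exp]
  have hint := integral_mono hh.abs hQ hyoung
  rw [integral_div, integral_add' ((hy'.add hxy').add hx') hu', integral_add' (hy'.add hxy') hx',
    integral_add' hy' hxy'] at hint
  simp only [integral_const_mul] at hint
  have := mul_le_mul_of_nonneg_left hsq (Real.exp_pos (2 * b * x)).le
  linarith
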